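/- Let p ≥ 2, let v_0 < v_1 < ⋯ < v_{p−1} be real numbers, and for each k < p − 1 let g_k > 0 satisfy v_{k+1} − v_k < 2 · g_k. For each k < p − 1 define the triangular membership functions μ_{v_k}(u) = max(0, 1 − |u − v_k|/g_k) and μ_{v_{k+1}}(u) = max(0, 1 − |u − v_{k+1}|/g_k). Then there exists ε > 0 such that for every u ∈ [v_0, v_{p−1}], at least one of these membership functions is ≥ ε at u; in particular the triangular fuzzy sets obtained from the partitioning algorithm cover the entire universe [v_0, v_{p−1}] with strictly positive membership. -/

import Mathlib

/-- A point between the first and last values of a finite sequence lies between two consecutive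
values. -/
theorem exists_lt_mem_Icc_succ (v : ℕ → ℝ) (u : ℝ) (n : ℕ) (hn : 0 < n)
    (hu : u ∈ Set.Icc (v 0) (v n)) : ∃ k < n, u ∈ Set.Icc (v k) (v (k + 1)) := by
  induction n, hn using Nat.le_induction with
  | base => exact ⟨0, Nat.one_pos, hu⟩
  | succ n _ ih =>
    rcases le_total u (v n) with h | h
    · obtain ⟨k, hk, hku⟩ := ih ⟨hu.1, h⟩
      exact ⟨k, hk.trans n.lt_succ_self, hku⟩
    · exact ⟨n, n.lt_succ_self, h, hu.2⟩

/-- On `[a, b]`, one of the two triangles of half-width `g` centred at the endpoints is at least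
its value at the midpoint. -/
theorem one_sub_le_max_triangular {a b g u : ℝ} (hg : 0 < g) (hu : u ∈ Set.Icc a b) :
    1 - (b - a) / 2 / g ≤ max (max 0 (1 - |u - a| / g)) (max 0 (1 - |u - b| / g)) := by
  rw [abs_of_nonneg (sub_nonneg.2 hu.1), abs_of_nonpos (sub_nonpos.2 hu.2)]
  rcases le_total (u - a) ((b - a) / 2) with h | h
  · refine le_max_of_le_left (le_max_of_le_right ?_)
    gcongr
  · refine le_max_of_le_right (le_max_of_le_right ?_)
    gcongr
    linarith

theorem stmt_8 (p : ℕ) (hp : 2 ≤ p) (v : ℕ → ℝ)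
    (hv : ∀ k, k + 1 ≤ p - 1 → v k < v (k + 1))
    (g : ℕ → ℝ) (hgpos : ∀ k, k < p - 1 → 0 < g k)
    (hgap : ∀ k, k < p - 1 → v (k + 1) - v k < 2 * g k) :
    ∃ ε > (0 : ℝ), ∀ u ∈ Set.Icc (v 0) (v (p - 1)),
      ∃ k, k < p - 1 ∧
        ε ≤ max (max 0 (1 - |u - v k| / g k)) (max 0 (1 - |u - v (k + 1)| / g k)) := by
  have hp' : 0 < p - 1 := by omega
  obtain ⟨m, hm, hmin⟩ := (Finset.range (p - 1)).exists_min_image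
    (fun k => 1 - (v (k + 1) - v k) / 2 / g k) ⟨0, Finset.mem_range.2 hp'⟩
  rw [Finset.mem_range] at hm
  refine ⟨1 - (v (m + 1) - v m) / 2 / g m, ?_, fun u hu => ?_⟩
  · have := hgap m hm
    rw [gt_iff_lt, sub_pos, div_lt_one (hgpos m hm)]
    linarith
  · obtain ⟨k, hk, hku⟩ := exists_lt_mem_Icc_succ v u (p - 1) hp' hu
    exact ⟨k, hk, (hmin k (Finset.mem_range.2 hk)).trans
      (one_sub_le_max_triangular (hgpos k hk) hku)⟩
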